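/- The pairs (2,3), (2,4), (2,6), (3,3) and (3,4) do not belong to B(3,2), while the pairs (2,5), (2,7), (2,11) and (8,3) belong to B(3,2). -/

import Mathlib

open Polynomial

noncomputable section

/-- An element of a finite field is *primitive* if it generates the multiplicative group. -/
def IsPrimitiveElem {L : Type} [Field L] [Fintype L] (α : L) : Prop :=
  orderOf α = Fintype.card L - 1

/-- `β` is a *normal element* of `L` over `K`, where `n = [L : K]`:
the conjugates `β, β^q, …, β^(q^(n-1))` form a `K`-basis of `L`. -/
def IsNormalElem (K : Type) {L : Type} [Field K] [Fintype K] [Field L] [Algebra K L]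
    (n : ℕ) (β : L) : Prop :=
  LinearIndependent K (fun i : Fin n => β ^ Fintype.card K ^ (i : ℕ)) ∧
    Submodule.span K (Set.range fun i : Fin n => β ^ Fintype.card K ^ (i : ℕ)) = ⊤

/-- The set `Υ_Q(m₁, m₂)` of rational functions over the field `F` with `Q` elements. -/
def Upsilon (F : Type) [Field F] [Fintype F] (m₁ m₂ : ℕ) : Set (RatFunc F) :=
  {f | ∃ f₁ f₂ : F[X], f₂ ≠ 0 ∧
      f = algebraMap F[X] (RatFunc F) f₁ / algebraMap F[X] (RatFunc F) f₂ ∧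
      f₁.natDegree ≤ m₁ ∧ f₂.natDegree ≤ m₂ ∧ IsCoprime f₁ f₂ ∧
      ∃ (k : ℕ) (g : F[X]), 0 < k ∧ g.Monic ∧ Irreducible g ∧ g ≠ X ∧
        Nat.gcd k (Fintype.card F - 1) = 1 ∧
        g ^ k ∣ f₁ * f₂ ∧ ¬ g ^ (k + 1) ∣ f₁ * f₂}

/-- Evaluation of a rational function at a point of the same field (`0` if undefined). -/
def ratEval {F : Type} [Field F] (f : RatFunc F) (α : F) : F :=
  f.eval (RingHom.id F) α

/-- `α` is `s`-free. -/
def IsFree {F : Type} [Field F] (s : ℕ) (α : F) : Prop :=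
  α ≠ 0 ∧ ∀ d : ℕ, d ∣ s → d ≠ 1 → ¬ ∃ β : F, β ^ d = α

/-- The `F_q[x]`-module action `h ∘ β = ∑ hᵢ β^(qⁱ)` on `L`. -/
def polyAct {K L : Type} [Field K] [Fintype K] [Field L] [Algebra K L]
    (h : K[X]) (β : L) : L :=
  h.sum fun i a => algebraMap K L a * β ^ Fintype.card K ^ i

/-- `α` is `g`-free with respect to the `F_q[x]`-module structure of `L`. -/
def IsPolyFree (K : Type) {L : Type} [Field K] [Fintype K] [Field L] [Algebra K L]
    (g : K[X]) (α : L) : Prop :=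
  ∀ h : K[X], h.Monic → h ∣ g → (∃ lam : L, α = polyAct h lam) → h = 1

/-- `N_f(e₁, e₂, g)`: the number of `α ∈ L` such that `α` is `e₁`-free,
`f(α)` is `e₂`-free and `α` is `g`-free. -/
def NElems (K : Type) {L : Type} [Field K] [Fintype K] [Field L] [Fintype L] [Algebra K L]
    (f : RatFunc L) (e₁ e₂ : ℕ) (g : K[X]) : ℕ :=
  Nat.card {α : L | IsFree e₁ α ∧ IsFree e₂ (ratEval f α) ∧ IsPolyFree K g α}

/-- `W(ℓ)`: the number of squarefree divisors of `ℓ`. -/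
def Wnat (ℓ : ℕ) : ℕ := (ℓ.divisors.filter Squarefree).card

/-- `W_q(g)`: the number of monic squarefree divisors of `g` in `F_q[x]`. -/
def Wpoly {K : Type} [Field K] (g : K[X]) : ℕ :=
  Nat.card {h : K[X] // h.Monic ∧ Squarefree h ∧ h ∣ g}

/-- `Φ(g) = |(F_q[x]/(g))ˣ|`. -/
def PhiPoly {K : Type} [Field K] (g : K[X]) : ℕ :=
  Nat.card ((K[X] ⧸ Ideal.span ({g} : Set K[X]))ˣ)

/-- `(q, n) ∈ B(m₁, m₂)`: for every `f ∈ Υ_{qⁿ}(m₁, m₂)` there is a primitive element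
`α` of `F_{qⁿ}`, normal over `F_q`, with `f(α)` also primitive. -/
def memB (m₁ m₂ q n : ℕ) : Prop :=
  ∀ (K L : Type) [Field K] [Field L] [Fintype K] [Fintype L] [Algebra K L],
    Fintype.card K = q → Fintype.card L = q ^ n →
    ∀ f ∈ Upsilon L m₁ m₂,
      ∃ α : L, IsPrimitiveElem α ∧ IsNormalElem K n α ∧ IsPrimitiveElem (ratEval f α)

/-- `𝔑(q, n)`: the number of primitive elements of `F_{qⁿ}` that are normal over `F_q`. -/
def NNum (K L : Type) [Field K] [Fintype K] [Field L] [Fintype L] [Algebra K L] (n : ℕ) : ℕ :=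
  Nat.card {α : L | IsPrimitiveElem α ∧ IsNormalElem K n α}

end


/-! ### General facts -/

lemma ratEval_div {F : Type} [Field F] (f₁ f₂ : F[X]) (h0 : f₂ ≠ 0) (α : F)
    (h : f₂.eval α ≠ 0) :
    ratEval (algebraMap F[X] (RatFunc F) f₁ / algebraMap F[X] (RatFunc F) f₂) α =
      f₁.eval α / f₂.eval α := by
  set x := algebraMap F[X] (RatFunc F) f₁ / algebraMap F[X] (RatFunc F) f₂ with hx
  have h1 : x.num * f₂ = f₁ * x.denom := (RatFunc.num_mul_eq_mul_denom_iff h0).2 hx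
  have h2 : x.denom ∣ f₂ := RatFunc.denom_div_dvd f₁ f₂
  have h3 : x.denom.eval α ≠ 0 := by
    intro h'
    exact h (Polynomial.eval_eq_zero_of_dvd_of_eval_eq_zero h2 h')
  have h4 := congrArg (Polynomial.eval α) h1
  simp only [Polynomial.eval_mul] at h4
  unfold ratEval RatFunc.eval
  change x.num.eval α / x.denom.eval α = _
  rw [div_eq_div_iff h3 h]
  exact h4

lemma not_upsilon_const {F : Type} [Field F] (f₁ f₂ g : F[X]) (k : ℕ) (hk : 0 < k)
    (hc : IsCoprime f₁ f₂) (hg : Irreducible g) (h1 : g ^ k ∣ f₁ * f₂)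
    (h2 : ¬ g ^ (k + 1) ∣ f₁ * f₂) (t : F) : f₁ - C t * f₂ ≠ 0 := by
  intro h
  have h' : f₁ = C t * f₂ := sub_eq_zero.1 h
  have hu : IsUnit f₂ := hc.isUnit_of_dvd' ⟨C t, by rw [h']; ring⟩ dvd_rfl
  have ht : t ≠ 0 := by
    rintro rfl
    apply h2
    rw [h']; simp
  have hu1 : IsUnit f₁ := by
    rw [h']
    exact (Polynomial.isUnit_C.2 ht.isUnit).mul hu
  have : IsUnit (g ^ k) := isUnit_of_dvd_unit h1 (hu1.mul hu)
  exact hg.not_isUnit ((isUnit_pow_iff hk.ne').1 this)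

open Classical in
lemma card_eval_zero {F : Type} [Field F] [Fintype F] (p : F[X]) (hp : p ≠ 0) (d : ℕ)
    (hd : p.natDegree ≤ d) : (Finset.univ.filter fun a : F => p.eval a = 0).card ≤ d := by
  refine le_trans ?_ ((Polynomial.card_roots' p).trans hd)
  refine le_trans (Finset.card_le_card ?_) (Multiset.toFinset_card_le _)
  intro a ha
  simp at ha
  simp [hp, ha]

open Classical in
/-- If the nonzero non-primitive elements lie in `T`, the number of `α` for which `f(α)` is not
primitive is at most `5 + 3|T|`. -/
lemma card_bad_f {F : Type} [Field F] [Fintype F] (f : RatFunc F) (hf : f ∈ Upsilon F 3 2)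
    (T : Finset F) (hT : ∀ a : F, a ≠ 0 → ¬ IsPrimitiveElem a → a ∈ T) :
    (Finset.univ.filter fun a : F => ¬ IsPrimitiveElem (ratEval f a)).card ≤ 5 + 3 * T.card := by
  obtain ⟨f₁, f₂, h0, rfl, hd1, hd2, hc, k, g, hk, -, hg, -, -, h1, h2⟩ := hf
  have hne := not_upsilon_const f₁ f₂ g k hk hc hg h1 h2
  have hf1 : f₁ ≠ 0 := by simpa using hne 0
  have hsub : (Finset.univ.filter fun a : F => ¬ IsPrimitiveElem (ratEval
      (algebraMap F[X] (RatFunc F) f₁ / algebraMap F[X] (RatFunc F) f₂) a)) ⊆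
      ((Finset.univ.filter fun a : F => f₁.eval a = 0) ∪
      (Finset.univ.filter fun a : F => f₂.eval a = 0)) ∪
      T.biUnion fun t => Finset.univ.filter fun a : F => (f₁ - C t * f₂).eval a = 0 := by
    intro a ha
    simp only [Finset.mem_filter, Finset.mem_univ, true_and] at ha
    simp only [Finset.mem_union, Finset.mem_filter, Finset.mem_univ, true_and, Finset.mem_biUnion]
    by_cases e1 : f₁.eval a = 0
    · exact Or.inl (Or.inl e1)
    by_cases e2 : f₂.eval a = 0
    · exact Or.inl (Or.inr e2)
    right
    rw [ratEval_div _ _ h0 _ e2] at ha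
    refine ⟨_, hT _ (div_ne_zero e1 e2) ha, ?_⟩
    simp [e2]
  refine (Finset.card_le_card hsub).trans ((Finset.card_union_le _ _).trans ?_)
  have c1 := (Finset.card_union_le (Finset.univ.filter fun a : F => f₁.eval a = 0)
    (Finset.univ.filter fun a : F => f₂.eval a = 0))
  have c2 := card_eval_zero f₁ hf1 3 hd1
  have c3 := card_eval_zero f₂ h0 2 hd2
  have c4 := Finset.card_biUnion_le_card_mul T
    (fun t => Finset.univ.filter fun a : F => (f₁ - C t * f₂).eval a = 0) 3 (by
      intro t _
      refine card_eval_zero _ (hne t) 3 ?_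
      refine (Polynomial.natDegree_sub_le _ _).trans (max_le hd1 ?_)
      exact (Polynomial.natDegree_C_mul_le _ _).trans (hd2.trans (by norm_num)))
  omega

open Classical in
/-- The nonzero non-primitive elements. -/
lemma card_nonprim {F : Type} [Field F] [Fintype F] :
    (Finset.univ.filter fun a : F => a ≠ 0 ∧ ¬ IsPrimitiveElem a).card ≤
      ∑ l ∈ (Fintype.card F - 1).primeFactors, (Fintype.card F - 1) / l := by
  have hQ : 0 < Fintype.card F - 1 := by
    have := Fintype.one_lt_card (α := F); omega
  have hsub : (Finset.univ.filter fun a : F => a ≠ 0 ∧ ¬ IsPrimitiveElem a) ⊆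
      (Fintype.card F - 1).primeFactors.biUnion fun l =>
        Finset.univ.filter fun a : F => a ^ ((Fintype.card F - 1) / l) = 1 := by
    intro a ha
    simp only [Finset.mem_filter, Finset.mem_univ, true_and] at ha
    obtain ⟨ha0, hap⟩ := ha
    have h1 : a ^ (Fintype.card F - 1) = 1 := FiniteField.pow_card_sub_one_eq_one a ha0
    by_contra hcon
    apply hap
    refine orderOf_eq_of_pow_and_pow_div_prime hQ h1 ?_
    intro p hp hpd h
    apply hcon
    simp only [Finset.mem_biUnion, Finset.mem_filter, Finset.mem_univ, true_and]
    exact ⟨p, Nat.mem_primeFactors.2 ⟨hp, hpd, hQ.ne'⟩, h⟩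
  refine (Finset.card_le_card hsub).trans (Finset.card_biUnion_le.trans ?_)
  refine Finset.sum_le_sum fun l hl => ?_
  have hl' := Nat.mem_primeFactors.1 hl
  have hpos : 0 < (Fintype.card F - 1) / l := Nat.div_pos (Nat.le_of_dvd hQ hl'.2.1) hl'.1.pos
  have := card_eval_zero (F := F) (X ^ ((Fintype.card F - 1) / l) - C 1)
    (Polynomial.X_pow_sub_C_ne_zero hpos _) _ (Polynomial.natDegree_X_pow_sub_C).le
  simpa [sub_eq_zero] using this

/-! ### Counting non-normal elements -/

/-- The Frobenius as a linear map. -/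
def frobLin (K L : Type) [Field K] [Fintype K] [Field L] [Algebra K L] : L →ₗ[K] L :=
  (FiniteField.frobeniusAlgHom K L).toLinearMap

lemma frobLin_pow (K : Type) {L : Type} [Field K] [Fintype K] [Field L] [Algebra K L]
    (i : ℕ) (b : L) : (frobLin K L ^ i) b = b ^ Fintype.card K ^ i := by
  induction i with
  | zero => simp
  | succ i ih =>
    rw [pow_succ', Module.End.mul_apply, ih]
    simp only [frobLin, AlgHom.toLinearMap_apply, FiniteField.frobeniusAlgHom_apply]
    rw [← pow_mul, pow_succ]

lemma aeval_frob (K : Type) {L : Type} [Field K] [Fintype K] [Field L] [Algebra K L]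
    (h : K[X]) (b : L) :
    aeval (frobLin K L) h b = h.sum fun i a => algebraMap K L a * b ^ Fintype.card K ^ i := by
  rw [Polynomial.aeval_eq_sum_range, Polynomial.sum_over_range]
  · simp [LinearMap.sum_apply, frobLin_pow, Algebra.smul_def]
  · simp

open Classical in
lemma card_ker {K L : Type} [Field K] [Fintype K] [Field L] [Fintype L] [Algebra K L]
    (R : K[X]) (hR : R ≠ 0) (r : ℕ) (hr : R.natDegree = r) :
    (Finset.univ.filter fun b : L => aeval (frobLin K L) R b = 0).card ≤ Fintype.card K ^ r := by
  have hq : 1 < Fintype.card K := Fintype.one_lt_card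
  set P : L[X] := ∑ i ∈ Finset.range (r + 1), C (algebraMap K L (R.coeff i)) *
    X ^ Fintype.card K ^ i with hP
  have hP0 : P ≠ 0 := by
    intro h
    have hc : P.coeff (Fintype.card K ^ r) = 0 := by rw [h]; simp
    rw [hP, Polynomial.finsetSum_coeff, Finset.sum_eq_single r] at hc
    · simp at hc
      apply hR
      rw [← Polynomial.leadingCoeff_eq_zero, Polynomial.leadingCoeff, hr]
      exact hc
    · intro i _ hi
      rw [Polynomial.coeff_C_mul_X_pow, if_neg]
      intro h'
      exact hi (Nat.pow_right_injective hq h').symm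
    · simp
  have hdeg : P.natDegree ≤ Fintype.card K ^ r := by
    refine Polynomial.natDegree_sum_le_of_forall_le _ _ ?_
    intro i hi
    refine (Polynomial.natDegree_C_mul_X_pow_le _ _).trans ?_
    exact Nat.pow_le_pow_right (by omega) (by simp at hi; omega)
  refine le_trans (Finset.card_le_card ?_) (card_eval_zero P hP0 _ hdeg)
  intro b hb
  simp only [Finset.mem_filter, Finset.mem_univ, true_and] at hb ⊢
  rw [← hb, aeval_frob, Polynomial.sum_over_range _ (by simp), hP, Polynomial.eval_finsetSum, hr]
  simp

lemma finrank_of_card {K L : Type} [Field K] [Fintype K] [Field L] [Fintype L] [Algebra K L]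
    (n : ℕ) (h : Fintype.card L = Fintype.card K ^ n) : Module.finrank K L = n := by
  have h1 := Module.card_eq_pow_finrank (K := K) (V := L)
  rw [h] at h1
  exact (Nat.pow_right_injective Fintype.one_lt_card h1).symm

/-- A non-normal element is killed by `N / P` for one of the irreducible factors `P` of
`N = X ^ n - 1`. -/
lemma nonnormal {K L : Type} [Field K] [Fintype K] [Field L] [Fintype L] [Algebra K L]
    (n : ℕ) (hn : 0 < n) (h : Fintype.card L = Fintype.card K ^ n) (s : Finset K[X])
    (hs : ∀ P ∈ s, Irreducible P) (hN : (X ^ n - 1 : K[X]) = ∏ P ∈ s, P)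
    (b : L) (hb : ¬ IsNormalElem K n b) :
    ∃ P ∈ s, ∃ R : K[X], X ^ n - 1 = P * R ∧ aeval (frobLin K L) R b = 0 := by
  have hfr := finrank_of_card n h
  have : Nonempty (Fin n) := ⟨⟨0, hn⟩⟩
  have hli : ¬ LinearIndependent K (fun i : Fin n => b ^ Fintype.card K ^ (i : ℕ)) := by
    intro hli
    exact hb ⟨hli, hli.span_eq_top_of_card_eq_finrank (by simp [hfr])⟩
  rw [Fintype.linearIndependent_iff] at hli
  push Not at hli
  obtain ⟨c, hc, i0, hi0⟩ := hli
  set H : K[X] := ∑ i : Fin n, C (c i) * X ^ (i : ℕ) with hH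
  have hH0 : H ≠ 0 := by
    intro h0
    have : H.coeff i0 = c i0 := by
      rw [hH, Polynomial.finsetSum_coeff, Finset.sum_eq_single i0]
      · simp
      · intro j _ hj
        rw [Polynomial.coeff_C_mul_X_pow, if_neg]
        intro h'
        exact hj (Fin.ext h'.symm)
      · simp
    rw [h0] at this
    exact hi0 (by simpa using this.symm)
  have hHd : H.natDegree < n := by
    have : H.natDegree ≤ n - 1 := by
      refine Polynomial.natDegree_sum_le_of_forall_le _ _ ?_
      intro i _
      refine (Polynomial.natDegree_C_mul_X_pow_le _ _).trans ?_
      have := i.2; omega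
    omega
  have hHb : aeval (frobLin K L) H b = 0 := by
    rw [hH, map_sum, LinearMap.sum_apply, ← hc]
    refine Finset.sum_congr rfl fun i _ => ?_
    simp [frobLin_pow, Module.algebraMap_end_apply]
  have hNb : aeval (frobLin K L) (X ^ n - 1 : K[X]) b = 0 := by
    simp [frobLin_pow, ← h, FiniteField.pow_card]
  have hN0 : (X ^ n - 1 : K[X]) ≠ 0 := by
    have := Polynomial.X_pow_sub_C_ne_zero hn (1 : K)
    simpa using this
  have hNd : (X ^ n - 1 : K[X]).natDegree = n := by
    have := Polynomial.natDegree_X_pow_sub_C (n := n) (r := (1 : K))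
    simpa using this
  classical
  set m := EuclideanDomain.gcd H (X ^ n - 1 : K[X]) with hm
  have hmb : aeval (frobLin K L) m b = 0 := by
    rw [hm, EuclideanDomain.gcd_eq_gcd_ab, mul_comm H, mul_comm (X ^ n - 1 : K[X])]
    simp only [map_add, map_mul, LinearMap.add_apply, Module.End.mul_apply, hHb, hNb, map_zero,
      add_zero]
  obtain ⟨k, hk⟩ : m ∣ X ^ n - 1 := EuclideanDomain.gcd_dvd_right _ _
  have hku : ¬ IsUnit k := by
    intro hu
    have h1 : (X ^ n - 1 : K[X]) ∣ m := by
      rw [hk]; exact (hu.mul_right_dvd).2 dvd_rfl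
    have h2 : (X ^ n - 1 : K[X]) ∣ H := h1.trans (EuclideanDomain.gcd_dvd_left _ _)
    have := Polynomial.natDegree_le_of_dvd h2 hH0
    omega
  have hk0 : k ≠ 0 := by
    rintro rfl
    exact hN0 (by simpa using hk)
  obtain ⟨Q, hQ, hQk⟩ := WfDvdMonoid.exists_irreducible_factor hku hk0
  have hQN : Q ∣ ∏ P ∈ s, P := by
    rw [← hN, hk]; exact hQk.mul_left m
  obtain ⟨P, hPs, hQP⟩ := (hQ.prime.dvd_finsetProd_iff _).1 hQN
  have hPk : P ∣ k := ((hQ.associated_of_dvd (hs P hPs) hQP).symm.dvd).trans hQk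
  obtain ⟨j, hj⟩ := hPk
  refine ⟨P, hPs, j * m, ?_, ?_⟩
  · rw [hk, hj]; ring
  · simp only [map_mul, Module.End.mul_apply, hmb, map_zero]

open Classical in
lemma card_nonnormal {K L : Type} [Field K] [Fintype K] [Field L] [Fintype L] [Algebra K L]
    (n : ℕ) (hn : 0 < n) (h : Fintype.card L = Fintype.card K ^ n) (s : Finset K[X])
    (hs : ∀ P ∈ s, Irreducible P) (hN : (X ^ n - 1 : K[X]) = ∏ P ∈ s, P) :
    (Finset.univ.filter fun b : L => ¬ IsNormalElem K n b).card ≤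
      ∑ P ∈ s, Fintype.card K ^ (n - P.natDegree) := by
  have hNd : (X ^ n - 1 : K[X]).natDegree = n := by
    have := Polynomial.natDegree_X_pow_sub_C (n := n) (r := (1 : K))
    simpa using this
  have hN0 : (X ^ n - 1 : K[X]) ≠ 0 := by
    have := Polynomial.X_pow_sub_C_ne_zero hn (1 : K)
    simpa using this
  have hsub : (Finset.univ.filter fun b : L => ¬ IsNormalElem K n b) ⊆
      s.biUnion fun P => Finset.univ.filter fun b : L =>
        aeval (frobLin K L) ((X ^ n - 1) / P) b = 0 := by
    intro b hb
    simp only [Finset.mem_filter, Finset.mem_univ, true_and] at hb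
    obtain ⟨P, hP, R, hR, hRb⟩ := nonnormal n hn h s hs hN b hb
    simp only [Finset.mem_biUnion, Finset.mem_filter, Finset.mem_univ, true_and]
    refine ⟨P, hP, ?_⟩
    rw [hR, mul_div_cancel_left₀ _ (hs P hP).ne_zero]
    exact hRb
  refine (Finset.card_le_card hsub).trans (Finset.card_biUnion_le.trans ?_)
  refine Finset.sum_le_sum fun P hP => ?_
  obtain ⟨R, hR⟩ : P ∣ X ^ n - 1 := by rw [hN]; exact Finset.dvd_prod_of_mem _ hP
  have hR0 : R ≠ 0 := by rintro rfl; exact hN0 (by simpa using hR)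
  have hq : (X ^ n - 1) / P = R := by
    rw [hR, mul_div_cancel_left₀ _ (hs P hP).ne_zero]
  rw [hq]
  refine card_ker R hR0 _ ?_
  have := congrArg Polynomial.natDegree hR
  rw [hNd, Polynomial.natDegree_mul (hs P hP).ne_zero hR0] at this
  omega

open Classical in
/-- The main counting criterion. -/
lemma memB_of_count {K L : Type} [Field K] [Fintype K] [Field L] [Fintype L] [Algebra K L]
    (n : ℕ) (hn : 0 < n) (h : Fintype.card L = Fintype.card K ^ n) (s : Finset K[X])
    (hs : ∀ P ∈ s, Irreducible P) (hN : (X ^ n - 1 : K[X]) = ∏ P ∈ s, P)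
    (hcount : ∑ P ∈ s, Fintype.card K ^ (n - P.natDegree) + 6 +
      4 * ∑ l ∈ (Fintype.card L - 1).primeFactors, (Fintype.card L - 1) / l < Fintype.card L)
    (f : RatFunc L) (hf : f ∈ Upsilon L 3 2) :
    ∃ α : L, IsPrimitiveElem α ∧ IsNormalElem K n α ∧ IsPrimitiveElem (ratEval f α) := by
  by_contra hcon
  push Not at hcon
  have hT := card_nonprim (F := L)
  set T := Finset.univ.filter fun a : L => a ≠ 0 ∧ ¬ IsPrimitiveElem a with hTdef
  have c1 := card_bad_f f hf T (fun a h1 h2 => by simp [hTdef, h1, h2])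
  have c2 := card_nonnormal (K := K) (L := L) n hn h s hs hN
  have hsub : (Finset.univ : Finset L) ⊆
      (((Finset.univ.filter fun b : L => ¬ IsNormalElem K n b) ∪ T) ∪ {0}) ∪
      (Finset.univ.filter fun a : L => ¬ IsPrimitiveElem (ratEval f a)) := by
    intro a _
    simp only [hTdef, Finset.mem_union, Finset.mem_filter, Finset.mem_univ, true_and,
      Finset.mem_singleton]
    have := hcon a
    tauto
  have c3 := Finset.card_le_card hsub
  have c4 := Finset.card_union_le
    (((Finset.univ.filter fun b : L => ¬ IsNormalElem K n b) ∪ T) ∪ {0})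
    (Finset.univ.filter fun a : L => ¬ IsPrimitiveElem (ratEval f a))
  have c5 := Finset.card_union_le
    ((Finset.univ.filter fun b : L => ¬ IsNormalElem K n b) ∪ T) {0}
  have c6 := Finset.card_union_le (Finset.univ.filter fun b : L => ¬ IsNormalElem K n b) T
  rw [Finset.card_univ] at c3
  rw [Finset.card_singleton] at c5
  omega

/-- If `q` has order `n - 1` modulo the prime `n`, the cyclotomic polynomial is irreducible. -/
lemma memB_prime (p e n : ℕ) [hp : Fact p.Prime] [hn : Fact n.Prime]
    (hpn : p.Coprime n) (hord : orderOf (ZMod.unitOfCoprime _ (hpn.pow_left e)) = n - 1)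
    (hn2 : 2 < n)
    (hcount : (p ^ e) ^ (n - 1) + p ^ e + 6 +
      4 * ∑ l ∈ ((p ^ e) ^ n - 1).primeFactors, ((p ^ e) ^ n - 1) / l < (p ^ e) ^ n) :
    memB 3 2 (p ^ e) n := by
  intro K L _ _ _ _ _ hK hL f hf
  have hdeg : (cyclotomic n K).natDegree = n - 1 := by
    rw [natDegree_cyclotomic, Nat.totient_prime hn.out]
  have hirr : Irreducible (cyclotomic n K) := by
    refine Polynomial.irreducible_of_dvd_cyclotomic_of_natDegree (f := e) (p := p)
      (by simpa using hK) hpn dvd_rfl ?_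
    rw [hdeg, hord]
  have hX : Irreducible (X - C 1 : K[X]) := Polynomial.irreducible_X_sub_C 1
  have hne : cyclotomic n K ≠ X - C 1 := by
    intro h
    have := congrArg Polynomial.natDegree h
    rw [hdeg, Polynomial.natDegree_X_sub_C] at this
    omega
  classical
  refine memB_of_count (K := K) (L := L) n (by omega) (by rw [hL, hK])
    {cyclotomic n K, X - C 1} ?_ ?_ ?_ f hf
  · intro P hP
    simp only [Finset.mem_insert, Finset.mem_singleton] at hP
    rcases hP with rfl | rfl
    · exact hirr
    · exact hX
  · rw [Finset.prod_pair hne, C_1, cyclotomic_prime_mul_X_sub_one]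
  · rw [Finset.sum_pair hne, hdeg, Polynomial.natDegree_X_sub_C, hK, hL]
    have : n - (n - 1) = 1 := by omega
    rw [this, pow_one]
    omega

lemma memB_2_5 : memB 3 2 2 5 := by
  have : Fact (Nat.Prime 5) := ⟨by norm_num⟩
  have h := memB_prime 2 1 5 (by norm_num) (by
    rw [← orderOf_units, ZMod.coe_unitOfCoprime, orderOf_eq_iff (by norm_num)]; decide)
    (by norm_num) (by
      rw [show (2 ^ 1) ^ 5 - 1 = 31 by norm_num, Nat.Prime.primeFactors (by norm_num)]
      norm_num)
  simpa using h

lemma memB_2_11 : memB 3 2 2 11 := by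
  have : Fact (Nat.Prime 11) := ⟨by norm_num⟩
  have h := memB_prime 2 1 11 (by norm_num) (by
    rw [← orderOf_units, ZMod.coe_unitOfCoprime, orderOf_eq_iff (by norm_num)]; decide)
    (by norm_num) (by
      rw [show (2 ^ 1) ^ 11 - 1 = 23 * 89 by norm_num,
        Nat.primeFactors_mul (by norm_num) (by norm_num),
        Nat.Prime.primeFactors (p := 23) (by norm_num),
        Nat.Prime.primeFactors (p := 89) (by norm_num),
        Finset.sum_union (by simp)]
      norm_num)
  simpa using h

lemma memB_8_3 : memB 3 2 8 3 := by
  have : Fact (Nat.Prime 3) := ⟨by norm_num⟩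
  have h := memB_prime 2 3 3 (by norm_num) (by
    rw [← orderOf_units, ZMod.coe_unitOfCoprime, orderOf_eq_iff (by norm_num)]; decide)
    (by norm_num) (by
      rw [show (2 ^ 3) ^ 3 - 1 = 7 * 73 by norm_num,
        Nat.primeFactors_mul (by norm_num) (by norm_num),
        Nat.Prime.primeFactors (p := 7) (by norm_num),
        Nat.Prime.primeFactors (p := 73) (by norm_num),
        Finset.sum_union (by simp)]
      norm_num)
  simpa using h

lemma memB_2_7 : memB 3 2 2 7 := by
  intro K L _ _ _ _ _ hK hL f hf
  have h7 : Fact (Nat.Prime 7) := ⟨by norm_num⟩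
  have hord : orderOf (ZMod.unitOfCoprime _
      ((by norm_num : Nat.Coprime 2 7).pow_left 1)) = 3 := by
    rw [← orderOf_units, ZMod.coe_unitOfCoprime, orderOf_eq_iff (by norm_num)]; decide
  have h2 : (2 : K) = 0 := by
    have := FiniteField.cast_card_eq_zero K
    rw [hK] at this
    exact_mod_cast this
  have h2' : (2 : K[X]) = 0 := by
    rw [← map_ofNat (C : K →+* K[X]) 2, h2, map_zero]
  have hcyc : cyclotomic 7 K = (X ^ 3 + X + 1) * (X ^ 3 + X ^ 2 + 1) := by
    rw [cyclotomic_prime]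
    simp only [Finset.sum_range_succ, Finset.sum_range_zero]
    linear_combination (-X ^ 3) * h2'
  have hd1 : (X ^ 3 + X + 1 : K[X]).natDegree = 3 := by compute_degree!
  have hd2 : (X ^ 3 + X ^ 2 + 1 : K[X]).natDegree = 3 := by compute_degree!
  have hX : Irreducible (X - C 1 : K[X]) := Polynomial.irreducible_X_sub_C 1
  have hi1 : Irreducible (X ^ 3 + X + 1 : K[X]) :=
    Polynomial.irreducible_of_dvd_cyclotomic_of_natDegree (f := 1) (p := 2) (n := 7)
      (by simpa using hK) (by norm_num) ⟨_, hcyc⟩ (by rw [hd1, hord])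
  have hi2 : Irreducible (X ^ 3 + X ^ 2 + 1 : K[X]) :=
    Polynomial.irreducible_of_dvd_cyclotomic_of_natDegree (f := 1) (p := 2) (n := 7)
      (by simpa using hK) (by norm_num) ⟨_, by rw [hcyc, mul_comm]⟩ (by rw [hd2, hord])
  have hne : (X ^ 3 + X + 1 : K[X]) ≠ X ^ 3 + X ^ 2 + 1 := by
    intro h
    have := congrArg (fun P => P.coeff 1) h
    simp [coeff_X, coeff_one] at this
  have hne1 : (X ^ 3 + X + 1 : K[X]) ≠ X - C 1 := by
    intro h
    have := congrArg Polynomial.natDegree h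
    rw [hd1, Polynomial.natDegree_X_sub_C] at this
    omega
  have hne2 : (X ^ 3 + X ^ 2 + 1 : K[X]) ≠ X - C 1 := by
    intro h
    have := congrArg Polynomial.natDegree h
    rw [hd2, Polynomial.natDegree_X_sub_C] at this
    omega
  classical
  have hmem : (X ^ 3 + X + 1 : K[X]) ∉ ({X ^ 3 + X ^ 2 + 1, X - C 1} : Finset K[X]) := by
    simp only [Finset.mem_insert, Finset.mem_singleton, not_or]
    exact ⟨hne, hne1⟩
  refine memB_of_count (K := K) (L := L) 7 (by omega) (by rw [hL, hK])
    {X ^ 3 + X + 1, X ^ 3 + X ^ 2 + 1, X - C 1} ?_ ?_ ?_ f hf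
  · intro P hP
    simp only [Finset.mem_insert, Finset.mem_singleton] at hP
    rcases hP with rfl | rfl | rfl
    · exact hi1
    · exact hi2
    · exact hX
  · rw [Finset.prod_insert hmem, Finset.prod_pair hne2, ← mul_assoc, ← hcyc, C_1,
      cyclotomic_prime_mul_X_sub_one]
  · rw [Finset.sum_insert hmem, Finset.sum_pair hne2, hd1, hd2, Polynomial.natDegree_X_sub_C,
      hK, hL, show 2 ^ 7 - 1 = 127 by norm_num, Nat.Prime.primeFactors (by norm_num)]
    norm_num

lemma case_2_3 {L : Type} [Field L] (hp : (2 : L) = 0) (x : L) (hQ0 : x ^ 7 = 1)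
    (hn1 : x ^ 1 ≠ 1) :
    (1) * x ^ 2 ^ 0 + (1) * x ^ 2 ^ 1 + (1) * x ^ 2 ^ 2 = 0 ∨
    (((x ^ 3 + x ^ 2)) ^ 1 = 1) := by
  have hQ : x ^ 7 - 1 = 0 := sub_eq_zero.2 hQ0
  have hprod : (x - 1) * (x ^ 3 + x ^ 2 + 1) * (x ^ 3 + x + 1) = 0 := by
    linear_combination (1) * hQ + (x ^ 4 - x ^ 3) * hp
  simp only [mul_eq_zero, or_assoc] at hprod
  rcases hprod with h0 | h1 | h2
  · exact absurd (by linear_combination h0) hn1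
  · right
    have e1 : x ^ 3 + x ^ 2 = 1 := by
      linear_combination (1) * h1 + (-1) * hp
    have p1 : (1 : L) ^ 1 = 1 := pow_one _
    rw [e1]; exact p1
  · left
    linear_combination (x) * h2 + (0) * hp

lemma case_2_4 {L : Type} [Field L] (hp : (2 : L) = 0) (x : L) (hQ0 : x ^ 15 = 1)
    (hn5 : x ^ 5 ≠ 1) (hn3 : x ^ 3 ≠ 1) :
    (1) * x ^ 2 ^ 0 + (1) * x ^ 2 ^ 1 + (1) * x ^ 2 ^ 2 + (1) * x ^ 2 ^ 3 = 0 ∨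
    (((x + 1)) ^ 5 = 1) := by
  have hQ : x ^ 15 - 1 = 0 := sub_eq_zero.2 hQ0
  have hprod : (x ^ 5 - 1) * (x ^ 3 - 1) * (x ^ 4 + x ^ 3 + 1) * (x ^ 4 + x + 1) = 0 := by
    linear_combination (x - 1) * hQ + (x ^ 15 + x ^ 12 - x ^ 10 - x ^ 9 - x ^ 7 - x ^ 6 + x ^ 4
      + x) * hp
  simp only [mul_eq_zero, or_assoc] at hprod
  rcases hprod with h0 | h1 | h2 | h3
  · exact absurd (by linear_combination h0) hn5
  · exact absurd (by linear_combination h1) hn3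
  · right
    have e1 : x + 1 = x + 1 := by
      linear_combination (0) * h2 + (0) * hp
    have p1 : (x + 1 : L) ^ 1 = x + 1 := pow_one _
    have p2 : (x + 1) ^ 2 = x ^ 2 + 1 := by
      rw [show 2 = 1 + 1 by norm_num, pow_add, p1]
      linear_combination (0) * h2 + (x) * hp
    have p4 : (x + 1) ^ 4 = x ^ 3 := by
      rw [show 4 = 2 + 2 by norm_num, pow_add, p2]
      linear_combination (1) * h2 + (-x ^ 3 + x ^ 2) * hp
    have p5 : (x + 1) ^ 5 = 1 := by
      rw [pow_succ, p4]
      linear_combination (1) * h2 + (-1) * hp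
    rw [e1]; exact p5
  · left
    linear_combination (x ^ 4 + x) * h3 + (-x ^ 5) * hp

lemma case_2_6 {L : Type} [Field L] (hp : (2 : L) = 0) (x : L) (hQ0 : x ^ 63 = 1)
    (hn21 : x ^ 21 ≠ 1) (hn9 : x ^ 9 ≠ 1) :
    (0) * x ^ 2 ^ 0 + (1) * x ^ 2 ^ 1 + (1) * x ^ 2 ^ 2 + (0) * x ^ 2 ^ 3 + (1) * x ^ 2 ^ 4 + (1) * x ^ 2 ^ 5 = 0 ∨
    (1) * x ^ 2 ^ 0 + (1) * x ^ 2 ^ 1 + (1) * x ^ 2 ^ 2 + (1) * x ^ 2 ^ 3 + (1) * x ^ 2 ^ 4 + (1) * x ^ 2 ^ 5 = 0 ∨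
    ((x + 1) ≠ 0 ∧ ((x ^ 3 + x ^ 2 + x) / (x + 1)) ^ 21 = 1) := by
  have hQ : x ^ 63 - 1 = 0 := sub_eq_zero.2 hQ0
  have hprod : (x ^ 21 - 1) * (x ^ 9 - 1) * (x ^ 6 + x ^ 5 + 1) * (x ^ 6 + x ^ 5 + x ^ 3 + x ^ 2
    + 1) * (x ^ 6 + x + 1) * (x ^ 6 + x ^ 5 + x ^ 4 + x + 1) * (x ^ 6 + x ^ 4 + x ^ 3 + x + 1) *
    (x ^ 6 + x ^ 5 + x ^ 2 + x + 1) = 0 := by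
    linear_combination (x ^ 3 - 1) * hQ + (2 * x ^ 65 + 4 * x ^ 64 + 7 * x ^ 63 + 10 * x ^ 62 +
      15 * x ^ 61 + 24 * x ^ 60 + 36 * x ^ 59 + 48 * x ^ 58 + 61 * x ^ 57 + 74 * x ^ 56 + 90 * x
      ^ 55 + 112 * x ^ 54 + 128 * x ^ 53 + 136 * x ^ 52 + 140 * x ^ 51 + 138 * x ^ 50 + 138 * x
      ^ 49 + 133 * x ^ 48 + 110 * x ^ 47 + 80 * x ^ 46 + 45 * x ^ 45 + 11 * x ^ 44 - 17 * x ^ 43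
      - 52 * x ^ 42 - 90 * x ^ 41 - 125 * x ^ 40 - 157 * x ^ 39 - 174 * x ^ 38 - 186 * x ^ 37 -
      201 * x ^ 36 - 210 * x ^ 35 - 218 * x ^ 34 - 224 * x ^ 33 - 218 * x ^ 32 - 210 * x ^ 31 -
      201 * x ^ 30 - 186 * x ^ 29 - 174 * x ^ 28 - 157 * x ^ 27 - 125 * x ^ 26 - 90 * x ^ 25 -
      52 * x ^ 24 - 17 * x ^ 23 + 11 * x ^ 22 + 45 * x ^ 21 + 80 * x ^ 20 + 110 * x ^ 19 + 133 *
      x ^ 18 + 138 * x ^ 17 + 138 * x ^ 16 + 140 * x ^ 15 + 136 * x ^ 14 + 128 * x ^ 13 + 112 *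
      x ^ 12 + 90 * x ^ 11 + 74 * x ^ 10 + 61 * x ^ 9 + 48 * x ^ 8 + 36 * x ^ 7 + 24 * x ^ 6 +
      15 * x ^ 5 + 10 * x ^ 4 + 7 * x ^ 3 + 4 * x ^ 2 + 2 * x) * hp
  simp only [mul_eq_zero, or_assoc] at hprod
  rcases hprod with h0 | h1 | h2 | h3 | h4 | h5 | h6 | h7
  · exact absurd (by linear_combination h0) hn21
  · exact absurd (by linear_combination h1) hn9
  · right; right
    have e2 : (x + 1) * (x ^ 5) = 1 := by
      linear_combination (1) * h2 + (-1) * hp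
    have e2n : x + 1 ≠ 0 := left_ne_zero_of_mul_eq_one e2
    have e1 : (x ^ 3 + x ^ 2 + x) / (x + 1) = x ^ 5 + x ^ 2 + 1 := by
      rw [div_eq_iff e2n]
      linear_combination (1) * h2 + (-x ^ 6 - x ^ 5 - 1) * hp
    have p1 : (x ^ 5 + x ^ 2 + 1 : L) ^ 1 = x ^ 5 + x ^ 2 + 1 := pow_one _
    have p2 : (x ^ 5 + x ^ 2 + 1) ^ 2 = x ^ 5 + x ^ 3 + x ^ 2 + x := by
      rw [show 2 = 1 + 1 by norm_num, pow_add, p1]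
      linear_combination (x ^ 4 + x ^ 3 + x ^ 2 + x + 1) * h2 + (-x ^ 9 - x ^ 8 - x ^ 6 - x ^ 3
        - x) * hp
    have p4 : (x ^ 5 + x ^ 2 + 1) ^ 4 = x ^ 3 + x := by
      rw [show 4 = 2 + 2 by norm_num, pow_add, p2]
      linear_combination (x ^ 4 + x ^ 3 + x ^ 2 + x) * h2 + (-x ^ 9 + x ^ 6 + x ^ 5 + x ^ 4 - x)
        * hp
    have p5 : (x ^ 5 + x ^ 2 + 1) ^ 5 = x ^ 5 + x ^ 2 := by
      rw [pow_succ, p4]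
      linear_combination (x ^ 2 + x) * h2 + (-x ^ 7 + x ^ 3 - x ^ 2) * hp
    have p10 : (x ^ 5 + x ^ 2 + 1) ^ 10 = x ^ 5 + x ^ 3 + x ^ 2 + x + 1 := by
      rw [show 10 = 5 + 5 by norm_num, pow_add, p5]
      linear_combination (x ^ 4 + x ^ 3 + x ^ 2 + x + 1) * h2 + (-x ^ 9 - x ^ 8 - x ^ 6 - x ^ 5
        - x ^ 3 - x ^ 2 - x - 1) * hp
    have p20 : (x ^ 5 + x ^ 2 + 1) ^ 20 = x ^ 3 + x + 1 := by
      rw [show 20 = 10 + 10 by norm_num, pow_add, p10]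
      linear_combination (x ^ 4 + x ^ 3 + x ^ 2 + x) * h2 + (-x ^ 9 + x ^ 6 + 2 * x ^ 5 + x ^ 4
        + x ^ 3 + x ^ 2) * hp
    have p21 : (x ^ 5 + x ^ 2 + 1) ^ 21 = 1 := by
      rw [pow_succ, p20]
      linear_combination (x ^ 2 + x) * h2 + (-x ^ 7 + x ^ 5 + x ^ 3) * hp
    refine ⟨e2n, ?_⟩
    rw [e1]; exact p21
  · left
    linear_combination (x ^ 26 + x ^ 25 + x ^ 24 + x ^ 19 + x ^ 16 + x ^ 12 + x ^ 11 + x ^ 10 +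
      x ^ 5 + x ^ 2) * h3 + (-x ^ 31 - x ^ 30 - x ^ 29 - x ^ 28 - x ^ 27 - x ^ 26 - x ^ 25 - x ^
      24 - x ^ 22 - x ^ 21 - x ^ 19 - x ^ 18 - x ^ 17 - x ^ 16 - x ^ 15 - x ^ 14 - x ^ 13 - x ^
      12 - x ^ 11 - x ^ 10 - x ^ 8 - x ^ 7 - x ^ 5) * hp
  · right; left
    linear_combination (x ^ 26 + x ^ 21 + x ^ 20 + x ^ 16 + x ^ 14 + x ^ 11 + x ^ 9 + x ^ 8 + x
      ^ 6 + x ^ 5 + x ^ 4 + x) * h4 + (-x ^ 27 - x ^ 26 - x ^ 22 - x ^ 21 - x ^ 20 - x ^ 17 - x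
      ^ 15 - x ^ 14 - x ^ 12 - x ^ 11 - x ^ 10 - x ^ 9 - x ^ 7 - x ^ 6 - x ^ 5) * hp
  · right; right
    have e2 : (x + 1) * (x ^ 5 + x ^ 3 + x ^ 2 + x) = 1 := by
      linear_combination (1) * h5 + (x ^ 3 + x ^ 2 - 1) * hp
    have e2n : x + 1 ≠ 0 := left_ne_zero_of_mul_eq_one e2
    have e1 : (x ^ 3 + x ^ 2 + x) / (x + 1) = x ^ 5 + x ^ 3 + x + 1 := by
      rw [div_eq_iff e2n]
      linear_combination (1) * h5 + (-x ^ 6 - x ^ 5 - x ^ 4 - x - 1) * hp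
    have p1 : (x ^ 5 + x ^ 3 + x + 1 : L) ^ 1 = x ^ 5 + x ^ 3 + x + 1 := pow_one _
    have p2 : (x ^ 5 + x ^ 3 + x + 1) ^ 2 = x ^ 3 + x + 1 := by
      rw [show 2 = 1 + 1 by norm_num, pow_add, p1]
      linear_combination (x ^ 4 + x ^ 3 + x) * h5 + (-x ^ 9 - x ^ 7 + x ^ 6) * hp
    have p4 : (x ^ 5 + x ^ 3 + x + 1) ^ 4 = x ^ 5 + x ^ 4 + x ^ 2 + x := by
      rw [show 4 = 2 + 2 by norm_num, pow_add, p2]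
      linear_combination (1) * h5 + (-x ^ 5 + x ^ 3) * hp
    have p5 : (x ^ 5 + x ^ 3 + x + 1) ^ 5 = x ^ 4 + x ^ 3 + x := by
      rw [pow_succ, p4]
      linear_combination (x ^ 4) * h5 + (x ^ 7 + x ^ 6 + x ^ 5 + x ^ 2) * hp
    have p10 : (x ^ 5 + x ^ 3 + x + 1) ^ 10 = x ^ 4 + x ^ 3 + x ^ 2 + 1 := by
      rw [show 10 = 5 + 5 by norm_num, pow_add, p5]
      linear_combination (x ^ 2 + x + 1) * h5 + (-x ^ 6 - x ^ 3 - x ^ 2 - x - 1) * hp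
    have p20 : (x ^ 5 + x ^ 3 + x + 1) ^ 20 = x ^ 3 := by
      rw [show 20 = 10 + 10 by norm_num, pow_add, p10]
      linear_combination (x ^ 2 + x + 1) * h5 + (x ^ 4 - x) * hp
    have p21 : (x ^ 5 + x ^ 3 + x + 1) ^ 21 = 1 := by
      rw [pow_succ, p20]
      linear_combination (x ^ 2 + x + 1) * h5 + (-x ^ 7 - x ^ 6 - x ^ 5 - x ^ 2 - x - 1) * hp
    refine ⟨e2n, ?_⟩
    rw [e1]; exact p21
  · right; left
    linear_combination (x ^ 26 + x ^ 24 + x ^ 23 + x ^ 22 + x ^ 21 + x ^ 20 + x ^ 19 + x ^ 16 +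
      x ^ 14 + x ^ 12 + x ^ 10 + x ^ 6 + x ^ 5 + x) * h6 + (-x ^ 30 - x ^ 29 - x ^ 28 - 2 * x ^
      27 - 2 * x ^ 26 - 2 * x ^ 25 - 2 * x ^ 24 - 2 * x ^ 23 - 2 * x ^ 22 - x ^ 21 - 2 * x ^ 20
      - x ^ 19 - x ^ 18 - x ^ 17 - x ^ 16 - x ^ 15 - x ^ 14 - x ^ 13 - x ^ 12 - x ^ 11 - x ^ 10
      - x ^ 9 - x ^ 7 - x ^ 6 - x ^ 5) * hp
  · right; right
    have e2 : (x + 1) * (x ^ 5 + x) = 1 := by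
      linear_combination (1) * h7 + (-1) * hp
    have e2n : x + 1 ≠ 0 := left_ne_zero_of_mul_eq_one e2
    have e1 : (x ^ 3 + x ^ 2 + x) / (x + 1) = x ^ 5 + x ^ 2 + x + 1 := by
      rw [div_eq_iff e2n]
      linear_combination (1) * h7 + (-x ^ 6 - x ^ 5 - x ^ 2 - x - 1) * hp
    have p1 : (x ^ 5 + x ^ 2 + x + 1 : L) ^ 1 = x ^ 5 + x ^ 2 + x + 1 := pow_one _
    have p2 : (x ^ 5 + x ^ 2 + x + 1) ^ 2 = x ^ 3 + x ^ 2 + x + 1 := by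
      rw [show 2 = 1 + 1 by norm_num, pow_add, p1]
      linear_combination (x ^ 4 + x ^ 3 + x ^ 2 + x) * h7 + (-x ^ 9 - x ^ 8 - x ^ 4 - x ^ 3) *
        hp
    have p4 : (x ^ 5 + x ^ 2 + x + 1) ^ 4 = x ^ 5 + x ^ 4 + x := by
      rw [show 4 = 2 + 2 by norm_num, pow_add, p2]
      linear_combination (1) * h7 + (x ^ 4 + 2 * x ^ 3 + x ^ 2) * hp
    have p5 : (x ^ 5 + x ^ 2 + x + 1) ^ 5 = x ^ 2 + x + 1 := by
      rw [pow_succ, p4]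
      linear_combination (x ^ 4 + x + 1) * h7 + (-x ^ 2 - x - 1) * hp
    have p10 : (x ^ 5 + x ^ 2 + x + 1) ^ 10 = x ^ 4 + x ^ 2 + 1 := by
      rw [show 10 = 5 + 5 by norm_num, pow_add, p5]
      linear_combination (0) * h7 + (x ^ 3 + x ^ 2 + x) * hp
    have p20 : (x ^ 5 + x ^ 2 + x + 1) ^ 20 = x ^ 5 + x ^ 2 := by
      rw [show 20 = 10 + 10 by norm_num, pow_add, p10]
      linear_combination (x ^ 2 + x + 1) * h7 + (-x ^ 7 - x ^ 5 + x ^ 4 - x ^ 3 - x ^ 2 - x) *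
        hp
    have p21 : (x ^ 5 + x ^ 2 + x + 1) ^ 21 = 1 := by
      rw [pow_succ, p20]
      linear_combination (x ^ 4 + x ^ 3 + x ^ 2 + x + 1) * h7 + (-x ^ 9 - x ^ 8 - x ^ 6 - x ^ 5
        - x ^ 4 - x ^ 3 - x ^ 2 - x - 1) * hp
    refine ⟨e2n, ?_⟩
    rw [e1]; exact p21

lemma case_3_3 {L : Type} [Field L] (hp : (3 : L) = 0) (x : L) (hQ0 : x ^ 26 = 1)
    (hn13 : x ^ 13 ≠ 1) (hn2 : x ^ 2 ≠ 1) :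
    (1) * x ^ 3 ^ 0 + (1) * x ^ 3 ^ 1 + (1) * x ^ 3 ^ 2 = 0 ∨
    (((-x ^ 3 - x ^ 2 - 1)) ^ 13 = 1) := by
  have hQ : x ^ 26 - 1 = 0 := sub_eq_zero.2 hQ0
  have hprod : (x ^ 13 - 1) * (x ^ 2 - 1) * (x ^ 3 - x ^ 2 + 1) * (x ^ 3 - x ^ 2 + x + 1) * (x ^
    3 - x + 1) * (x ^ 3 + x ^ 2 - x + 1) = 0 := by
    linear_combination (x - 1) * hQ + (-x ^ 25 + 3 * x ^ 24 - x ^ 23 - 5 * x ^ 22 + 7 * x ^ 21 -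
      7 * x ^ 19 + 5 * x ^ 18 + x ^ 17 - 3 * x ^ 16 + x ^ 15 + x ^ 12 - 3 * x ^ 11 + x ^ 10 + 5
      * x ^ 9 - 7 * x ^ 8 + 7 * x ^ 6 - 5 * x ^ 5 - x ^ 4 + 3 * x ^ 3 - x ^ 2) * hp
  simp only [mul_eq_zero, or_assoc] at hprod
  rcases hprod with h0 | h1 | h2 | h3 | h4 | h5
  · exact absurd (by linear_combination h0) hn13
  · exact absurd (by linear_combination h1) hn2
  · right
    have e1 : -x ^ 3 - x ^ 2 - 1 = x ^ 2 := by
      linear_combination (-1) * h2 + (-x ^ 2) * hp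
    have p1 : (x ^ 2 : L) ^ 1 = x ^ 2 := pow_one _
    have p2 : (x ^ 2) ^ 2 = x ^ 2 - x - 1 := by
      rw [show 2 = 1 + 1 by norm_num, pow_add, p1]
      linear_combination (x + 1) * h2 + (0) * hp
    have p3 : (x ^ 2) ^ 3 = -x ^ 2 - x := by
      rw [pow_succ, p2]
      linear_combination (x) * h2 + (0) * hp
    have p6 : (x ^ 2) ^ 6 = x ^ 2 - x := by
      rw [show 6 = 3 + 3 by norm_num, pow_add, p3]
      linear_combination (x) * h2 + (x ^ 3) * hp
    have p12 : (x ^ 2) ^ 12 = -x + 1 := by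
      rw [show 12 = 6 + 6 by norm_num, pow_add, p6]
      linear_combination (x - 1) * h2 + (0) * hp
    have p13 : (x ^ 2) ^ 13 = 1 := by
      rw [pow_succ, p12]
      linear_combination (-1) * h2 + (0) * hp
    rw [e1]; exact p13
  · right
    have e1 : -x ^ 3 - x ^ 2 - 1 = x ^ 2 + x := by
      linear_combination (-1) * h3 + (-x ^ 2) * hp
    have p1 : (x ^ 2 + x : L) ^ 1 = x ^ 2 + x := pow_one _
    have p2 : (x ^ 2 + x) ^ 2 = -x := by
      rw [show 2 = 1 + 1 by norm_num, pow_add, p1]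
      linear_combination (x) * h3 + (x ^ 3) * hp
    have p3 : (x ^ 2 + x) ^ 3 = x ^ 2 + x + 1 := by
      rw [pow_succ, p2]
      linear_combination (-1) * h3 + (-x ^ 2) * hp
    have p6 : (x ^ 2 + x) ^ 6 = -x ^ 2 + x + 1 := by
      rw [show 6 = 3 + 3 by norm_num, pow_add, p3]
      linear_combination (x) * h3 + (x ^ 3 + x ^ 2) * hp
    have p12 : (x ^ 2 + x) ^ 12 = -x - 1 := by
      rw [show 12 = 6 + 6 by norm_num, pow_add, p6]
      linear_combination (x - 1) * h3 + (-x ^ 2 + x + 1) * hp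
    have p13 : (x ^ 2 + x) ^ 13 = 1 := by
      rw [pow_succ, p12]
      linear_combination (-1) * h3 + (-x ^ 2) * hp
    rw [e1]; exact p13
  · left
    linear_combination (x ^ 6 + x ^ 4 - x ^ 3 + x ^ 2 + x) * h4 + (-x ^ 4 + x ^ 3) * hp
  · right
    have e1 : -x ^ 3 - x ^ 2 - 1 = -x := by
      linear_combination (-1) * h5 + (0) * hp
    have p1 : (-x : L) ^ 1 = -x := pow_one _
    have p2 : (-x) ^ 2 = x ^ 2 := by
      rw [show 2 = 1 + 1 by norm_num, pow_add, p1]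
      linear_combination (0) * h5 + (0) * hp
    have p3 : (-x) ^ 3 = x ^ 2 - x + 1 := by
      rw [pow_succ, p2]
      linear_combination (-1) * h5 + (0) * hp
    have p6 : (-x) ^ 6 = x ^ 2 + 1 := by
      rw [show 6 = 3 + 3 by norm_num, pow_add, p3]
      linear_combination (x) * h5 + (-x ^ 3 + x ^ 2 - x) * hp
    have p12 : (-x) ^ 12 = x ^ 2 + x - 1 := by
      rw [show 12 = 6 + 6 by norm_num, pow_add, p6]
      linear_combination (x - 1) * h5 + (x ^ 2 - x + 1) * hp
    have p13 : (-x) ^ 13 = 1 := by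
      rw [pow_succ, p12]
      linear_combination (-1) * h5 + (0) * hp
    rw [e1]; exact p13

lemma case_3_4 {L : Type} [Field L] (hp : (3 : L) = 0) (x : L) (hQ0 : x ^ 80 = 1)
    (hn40 : x ^ 40 ≠ 1) (hn16 : x ^ 16 ≠ 1) :
    (1) * x ^ 3 ^ 0 + (1) * x ^ 3 ^ 1 + (1) * x ^ 3 ^ 2 + (1) * x ^ 3 ^ 3 = 0 ∨
    (1) * x ^ 3 ^ 0 + (-1) * x ^ 3 ^ 1 + (1) * x ^ 3 ^ 2 + (-1) * x ^ 3 ^ 3 = 0 ∨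
    (((x ^ 2 - 1)) ^ 16 = 1) ∨
    (((x ^ 2 - 1)) ^ 40 = 1) := by
  have hQ : x ^ 80 - 1 = 0 := sub_eq_zero.2 hQ0
  have hprod : (x ^ 40 - 1) * (x ^ 16 - 1) * (x ^ 4 + x ^ 3 - 1) * (x ^ 4 - x ^ 3 - 1) * (x ^ 4
    + x - 1) * (x ^ 4 - x ^ 3 + x ^ 2 + x - 1) * (x ^ 4 - x ^ 3 - x ^ 2 + x - 1) * (x ^ 4 - x -
    1) * (x ^ 4 + x ^ 3 + x ^ 2 - x - 1) * (x ^ 4 + x ^ 3 - x ^ 2 - x - 1) = 0 := by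
    linear_combination (x ^ 8 - 1) * hQ + (-x ^ 86 - x ^ 84 + 2 * x ^ 82 + 9 * x ^ 80 - 5 * x ^
      78 - 22 * x ^ 76 + 2 * x ^ 74 + 32 * x ^ 72 + 3 * x ^ 70 - 21 * x ^ 68 - 7 * x ^ 66 + 7 *
      x ^ 62 + 21 * x ^ 60 - 3 * x ^ 58 - 32 * x ^ 56 - 2 * x ^ 54 + 22 * x ^ 52 + 5 * x ^ 50 -
      9 * x ^ 48 - x ^ 46 + 2 * x ^ 44 - x ^ 42 - 9 * x ^ 40 + 5 * x ^ 38 + 22 * x ^ 36 - 2 * x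
      ^ 34 - 32 * x ^ 32 - 3 * x ^ 30 + 21 * x ^ 28 + 7 * x ^ 26 - 7 * x ^ 22 - 21 * x ^ 20 + 3
      * x ^ 18 + 32 * x ^ 16 + 2 * x ^ 14 - 22 * x ^ 12 - 5 * x ^ 10 + 9 * x ^ 8 + 2 * x ^ 6 - x
      ^ 4 - x ^ 2) * hp
  simp only [mul_eq_zero, or_assoc] at hprod
  rcases hprod with h0 | h1 | h2 | h3 | h4 | h5 | h6 | h7 | h8 | h9
  · exact absurd (by linear_combination h0) hn40
  · exact absurd (by linear_combination h1) hn16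
  · right; right; left
    have e1 : x ^ 2 - 1 = x ^ 2 - 1 := by
      linear_combination (0) * h2 + (0) * hp
    have p1 : (x ^ 2 - 1 : L) ^ 1 = x ^ 2 - 1 := pow_one _
    have p2 : (x ^ 2 - 1) ^ 2 = -x ^ 3 + x ^ 2 - 1 := by
      rw [show 2 = 1 + 1 by norm_num, pow_add, p1]
      linear_combination (1) * h2 + (-x ^ 2 + 1) * hp
    have p4 : (x ^ 2 - 1) ^ 4 = x ^ 3 - x ^ 2 - 1 := by
      rw [show 4 = 2 + 2 by norm_num, pow_add, p2]
      linear_combination (x ^ 2 + 1) * h2 + (-x ^ 5 + 1) * hp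
    have p8 : (x ^ 2 - 1) ^ 8 = -1 := by
      rw [show 8 = 4 + 4 by norm_num, pow_add, p4]
      linear_combination (x ^ 2 + 1) * h2 + (-x ^ 5 - x ^ 3 + x ^ 2 + 1) * hp
    have p16 : (x ^ 2 - 1) ^ 16 = 1 := by
      rw [show 16 = 8 + 8 by norm_num, pow_add, p8]
      linear_combination (0) * h2 + (0) * hp
    rw [e1]; exact p16
  · right; right; left
    have e1 : x ^ 2 - 1 = x ^ 2 - 1 := by
      linear_combination (0) * h3 + (0) * hp
    have p1 : (x ^ 2 - 1 : L) ^ 1 = x ^ 2 - 1 := pow_one _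
    have p2 : (x ^ 2 - 1) ^ 2 = x ^ 3 + x ^ 2 - 1 := by
      rw [show 2 = 1 + 1 by norm_num, pow_add, p1]
      linear_combination (1) * h3 + (-x ^ 2 + 1) * hp
    have p4 : (x ^ 2 - 1) ^ 4 = -x ^ 3 - x ^ 2 - 1 := by
      rw [show 4 = 2 + 2 by norm_num, pow_add, p2]
      linear_combination (x ^ 2 + 1) * h3 + (x ^ 5 + 1) * hp
    have p8 : (x ^ 2 - 1) ^ 8 = -1 := by
      rw [show 8 = 4 + 4 by norm_num, pow_add, p4]
      linear_combination (x ^ 2 + 1) * h3 + (x ^ 5 + x ^ 3 + x ^ 2 + 1) * hp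
    have p16 : (x ^ 2 - 1) ^ 16 = 1 := by
      rw [show 16 = 8 + 8 by norm_num, pow_add, p8]
      linear_combination (0) * h3 + (0) * hp
    rw [e1]; exact p16
  · left
    linear_combination (x ^ 23 - x ^ 20 + x ^ 19 + x ^ 17 + x ^ 16 + x ^ 15 - x ^ 14 - x ^ 11 -
      x ^ 10 + x ^ 8 - x ^ 6 + x ^ 4 + x ^ 3 - x ^ 2 - x) * h4 + (-x ^ 20 + x ^ 15 + x ^ 3) * hp
  · right; right; right
    have e1 : x ^ 2 - 1 = x ^ 2 - 1 := by
      linear_combination (0) * h5 + (0) * hp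
    have p1 : (x ^ 2 - 1 : L) ^ 1 = x ^ 2 - 1 := pow_one _
    have p2 : (x ^ 2 - 1) ^ 2 = x ^ 3 - x - 1 := by
      rw [show 2 = 1 + 1 by norm_num, pow_add, p1]
      linear_combination (1) * h5 + (-x ^ 2 + 1) * hp
    have p4 : (x ^ 2 - 1) ^ 4 = -x - 1 := by
      rw [show 4 = 2 + 2 by norm_num, pow_add, p2]
      linear_combination (x ^ 2 + x + 1) * h5 + (-x ^ 4 - x ^ 3 + x + 1) * hp
    have p5 : (x ^ 2 - 1) ^ 5 = -x ^ 3 - x ^ 2 + x + 1 := by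
      rw [pow_succ, p4]
      linear_combination (0) * h5 + (0) * hp
    have p10 : (x ^ 2 - 1) ^ 10 = -x ^ 3 - x ^ 2 + x - 1 := by
      rw [show 10 = 5 + 5 by norm_num, pow_add, p5]
      linear_combination (x ^ 2 + 1) * h5 + (x ^ 5 - x ^ 4 - x ^ 3 + 1) * hp
    have p20 : (x ^ 2 - 1) ^ 20 = -1 := by
      rw [show 20 = 10 + 10 by norm_num, pow_add, p10]
      linear_combination (x ^ 2 + 1) * h5 + (x ^ 5 - x ^ 4 + x ^ 2 - x + 1) * hp
    have p40 : (x ^ 2 - 1) ^ 40 = 1 := by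
      rw [show 40 = 20 + 20 by norm_num, pow_add, p20]
      linear_combination (0) * h5 + (0) * hp
    rw [e1]; exact p40
  · right; left
    linear_combination (-x ^ 23 - x ^ 22 + x ^ 21 + x ^ 20 - x ^ 19 + x ^ 18 + x ^ 15 - x ^ 14 +
      x ^ 12 - x ^ 9 - x ^ 7 - x ^ 5 + x ^ 3 - x ^ 2 - x) * h6 + (-x ^ 25 + x ^ 23 - x ^ 22 + x
      ^ 20 - x ^ 19 + x ^ 18 - x ^ 16 + x ^ 15 - x ^ 7 + x ^ 6 - x ^ 4) * hp
  · left
    linear_combination (x ^ 23 + x ^ 20 + x ^ 19 + x ^ 17 - x ^ 16 + x ^ 15 + x ^ 14 - x ^ 11 +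
      x ^ 10 - x ^ 8 + x ^ 6 - x ^ 4 + x ^ 3 + x ^ 2 - x) * h7 + (x ^ 20 + x ^ 15 + x ^ 3) * hp
  · right; right; right
    have e1 : x ^ 2 - 1 = x ^ 2 - 1 := by
      linear_combination (0) * h8 + (0) * hp
    have p1 : (x ^ 2 - 1 : L) ^ 1 = x ^ 2 - 1 := pow_one _
    have p2 : (x ^ 2 - 1) ^ 2 = -x ^ 3 + x - 1 := by
      rw [show 2 = 1 + 1 by norm_num, pow_add, p1]
      linear_combination (1) * h8 + (-x ^ 2 + 1) * hp
    have p4 : (x ^ 2 - 1) ^ 4 = x - 1 := by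
      rw [show 4 = 2 + 2 by norm_num, pow_add, p2]
      linear_combination (x ^ 2 - x + 1) * h8 + (-x ^ 4 + x ^ 3 - x + 1) * hp
    have p5 : (x ^ 2 - 1) ^ 5 = x ^ 3 - x ^ 2 - x + 1 := by
      rw [pow_succ, p4]
      linear_combination (0) * h8 + (0) * hp
    have p10 : (x ^ 2 - 1) ^ 10 = x ^ 3 - x ^ 2 - x - 1 := by
      rw [show 10 = 5 + 5 by norm_num, pow_add, p5]
      linear_combination (x ^ 2 + 1) * h8 + (-x ^ 5 - x ^ 4 + x ^ 3 + 1) * hp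
    have p20 : (x ^ 2 - 1) ^ 20 = -1 := by
      rw [show 20 = 10 + 10 by norm_num, pow_add, p10]
      linear_combination (x ^ 2 + 1) * h8 + (-x ^ 5 - x ^ 4 + x ^ 2 + x + 1) * hp
    have p40 : (x ^ 2 - 1) ^ 40 = 1 := by
      rw [show 40 = 20 + 20 by norm_num, pow_add, p20]
      linear_combination (0) * h8 + (0) * hp
    rw [e1]; exact p40
  · right; left
    linear_combination (-x ^ 23 + x ^ 22 + x ^ 21 - x ^ 20 - x ^ 19 - x ^ 18 + x ^ 15 + x ^ 14 -
      x ^ 12 - x ^ 9 - x ^ 7 - x ^ 5 + x ^ 3 + x ^ 2 - x) * h9 + (-x ^ 25 + x ^ 23 + x ^ 22 - x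
      ^ 20 - x ^ 19 - x ^ 18 + x ^ 16 + x ^ 15 - x ^ 7 - x ^ 6 + x ^ 4) * hp

/-! ### The negative cases -/

lemma not_memB (p n : ℕ) [Fact p.Prime] (hn : n ≠ 0)
    (H : ∀ (L : Type) [Field L] [Fintype L] [Algebra (ZMod p) L], (p : L) = 0 →
      Fintype.card L = p ^ n → ∃ f ∈ Upsilon L 3 2, ∀ α : L, orderOf α = p ^ n - 1 →
        LinearIndependent (ZMod p) (fun i : Fin n => α ^ p ^ (i : ℕ)) →
        orderOf (ratEval f α) ≠ p ^ n - 1) : ¬ memB 3 2 p n := by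
  intro h
  let _ : Fintype (GaloisField p n) := Fintype.ofFinite _
  have hcard : Fintype.card (GaloisField p n) = p ^ n := by
    rw [← Nat.card_eq_fintype_card, GaloisField.card p n hn]
  obtain ⟨f, hf, hH⟩ := H (GaloisField p n) (CharP.cast_eq_zero _ p) hcard
  obtain ⟨α, h1, h2, h3⟩ := h (ZMod p) (GaloisField p n) (ZMod.card p) hcard f hf
  unfold IsPrimitiveElem at h1 h3
  rw [hcard] at h1 h3
  have h4 := h2.1
  rw [ZMod.card p] at h4
  exact hH α h1 h4 h3

lemma mem_upsilon {F : Type} [Field F] [Fintype F] (f₁ f₂ w : F[X]) (hf2 : f₂ ≠ 0)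
    (h1 : f₁.natDegree ≤ 3) (h2 : f₂.natDegree ≤ 2) (hc : IsCoprime f₁ f₂)
    (hw : f₁ * f₂ = (X - C 1) * w) (hw1 : w.eval 1 ≠ 0) :
    algebraMap F[X] (RatFunc F) f₁ / algebraMap F[X] (RatFunc F) f₂ ∈ Upsilon F 3 2 := by
  refine ⟨f₁, f₂, hf2, rfl, h1, h2, hc, 1, X - C 1, one_pos, monic_X_sub_C 1,
    irreducible_X_sub_C 1, ?_, Nat.gcd_one_left _, ?_, ?_⟩
  · intro h
    have := congrArg (Polynomial.eval 0) h
    simp at this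
  · rw [pow_one, hw]; exact Dvd.intro _ rfl
  · rintro ⟨r, hr⟩
    rw [hw, show (X - C 1 : F[X]) ^ (1 + 1) * r = (X - C 1) * ((X - C 1) * r) by ring] at hr
    have := mul_left_cancel₀ (Polynomial.X_sub_C_ne_zero 1) hr
    apply hw1
    rw [this]
    simp

lemma pow_ne_of_order {L : Type} [Field L] {α : L} {N : ℕ} (h : orderOf α = N) (e : ℕ)
    (he : 0 < e) (heN : e < N) : α ^ e ≠ 1 := by
  intro h'
  have := Nat.le_of_dvd he (orderOf_dvd_of_pow_eq_one h')
  omega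

lemma pow_order {L : Type} [Field L] {α : L} {N : ℕ} (h : orderOf α = N) : α ^ N = 1 := by
  rw [← h]; exact pow_orderOf_eq_one α

lemma ratEval_poly {F : Type} [Field F] (f₁ : F[X]) (α : F) :
    ratEval (algebraMap F[X] (RatFunc F) f₁ / algebraMap F[X] (RatFunc F) 1) α =
      f₁.eval α := by
  rw [ratEval_div _ _ one_ne_zero _ (by simp)]; simp

lemma castX {F : Type} [Field F] {p : ℕ} (h : (p : F) = 0) : (p : F[X]) = 0 := by
  rw [← map_natCast (C : F →+* F[X]) p, h, map_zero]

lemma not_memB_2_3 : ¬ memB 3 2 2 3 := by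
  refine not_memB 2 3 (by norm_num) fun L _ _ _ hp _ => ?_
  have hpX := castX hp
  push_cast at hp hpX
  refine ⟨algebraMap L[X] (RatFunc L) (X ^ 3 + X ^ 2) / algebraMap L[X] (RatFunc L) 1,
    mem_upsilon _ _ (X ^ 2) one_ne_zero (by compute_degree) (by simp) isCoprime_one_right
      (by rw [C_1]; linear_combination (X ^ 2) * hpX) (by simp), ?_⟩
  intro α hα hli ho
  norm_num at hα
  rw [ratEval_poly] at ho
  simp only [eval_add, eval_sub, eval_neg, eval_pow, eval_X, eval_one] at ho
  have hli' := Fintype.linearIndependent_iff.1 hli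
  rcases case_2_3 hp α (pow_order hα) (pow_ne_of_order hα 1 (by norm_num) (by norm_num)) with
    h | h
  · have := hli' ![1, 1, 1] (by simp [Fin.sum_univ_succ]; linear_combination h) 0
    revert this; decide
  · exact pow_ne_of_order ho 1 (by norm_num) (by norm_num) h

lemma not_memB_2_4 : ¬ memB 3 2 2 4 := by
  refine not_memB 2 4 (by norm_num) fun L _ _ _ hp _ => ?_
  have hpX := castX hp
  push_cast at hp hpX
  refine ⟨algebraMap L[X] (RatFunc L) (X + 1) / algebraMap L[X] (RatFunc L) 1,
    mem_upsilon _ _ 1 one_ne_zero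
      ((by compute_degree : (X + 1 : L[X]).natDegree ≤ 1).trans (by norm_num)) (by simp) isCoprime_one_right
      (by rw [C_1]; linear_combination hpX) (by simp), ?_⟩
  intro α hα hli ho
  norm_num at hα
  rw [ratEval_poly] at ho
  simp only [eval_add, eval_sub, eval_neg, eval_pow, eval_X, eval_one] at ho
  have hli' := Fintype.linearIndependent_iff.1 hli
  rcases case_2_4 hp α (pow_order hα) (pow_ne_of_order hα 5 (by norm_num) (by norm_num))
    (pow_ne_of_order hα 3 (by norm_num) (by norm_num)) with h | h
  · have := hli' ![1, 1, 1, 1] (by simp [Fin.sum_univ_succ]; linear_combination h) 0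
    revert this; decide
  · exact pow_ne_of_order ho 5 (by norm_num) (by norm_num) h

lemma not_memB_2_6 : ¬ memB 3 2 2 6 := by
  refine not_memB 2 6 (by norm_num) fun L _ _ _ hp _ => ?_
  have hpX := castX hp
  push_cast at hp hpX
  have h0 : (X + 1 : L[X]) ≠ 0 := by
    intro h
    have := congrArg (Polynomial.eval 0) h
    simp at this
  refine ⟨algebraMap L[X] (RatFunc L) (X ^ 3 + X ^ 2 + X) / algebraMap L[X] (RatFunc L) (X + 1),
    mem_upsilon _ _ (X ^ 3 + X ^ 2 + X) h0 (by compute_degree)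
      ((by compute_degree : (X + 1 : L[X]).natDegree ≤ 1).trans (by norm_num))
      ⟨-1, X ^ 2 + 1, by ring⟩
      (by rw [C_1]; linear_combination (X ^ 3 + X ^ 2 + X) * hpX) ?_, ?_⟩
  · simp only [eval_add, eval_pow, eval_X]
    intro h
    exact one_ne_zero (α := L) (by linear_combination h - hp)
  intro α hα hli ho
  norm_num at hα
  have hli' := Fintype.linearIndependent_iff.1 hli
  rcases case_2_6 hp α (pow_order hα) (pow_ne_of_order hα 21 (by norm_num) (by norm_num))
    (pow_ne_of_order hα 9 (by norm_num) (by norm_num)) with h | h | ⟨hne, h⟩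
  · have := hli' ![0, 1, 1, 0, 1, 1] (by simp [Fin.sum_univ_succ]; linear_combination h) 1
    revert this; decide
  · have := hli' ![1, 1, 1, 1, 1, 1] (by simp [Fin.sum_univ_succ]; linear_combination h) 0
    revert this; decide
  · rw [ratEval_div _ _ h0 _ (by simpa using hne)] at ho
    simp only [eval_add, eval_sub, eval_neg, eval_pow, eval_X, eval_one] at ho
    exact pow_ne_of_order ho 21 (by norm_num) (by norm_num) h

lemma not_memB_3_3 : ¬ memB 3 2 3 3 := by
  refine not_memB 3 3 (by norm_num) fun L _ _ _ hp _ => ?_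
  have hpX := castX hp
  push_cast at hp hpX
  refine ⟨algebraMap L[X] (RatFunc L) (-X ^ 3 - X ^ 2 - 1) / algebraMap L[X] (RatFunc L) 1,
    mem_upsilon _ _ (-X ^ 2 + X + 1) one_ne_zero (by compute_degree) (by simp)
      isCoprime_one_right (by rw [C_1]; linear_combination (-X ^ 2) * hpX) (by simp), ?_⟩
  intro α hα hli ho
  norm_num at hα
  rw [ratEval_poly] at ho
  simp only [eval_add, eval_sub, eval_neg, eval_pow, eval_X, eval_one] at ho
  have hli' := Fintype.linearIndependent_iff.1 hli
  rcases case_3_3 hp α (pow_order hα) (pow_ne_of_order hα 13 (by norm_num) (by norm_num))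
    (pow_ne_of_order hα 2 (by norm_num) (by norm_num)) with h | h
  · have := hli' ![1, 1, 1] (by simp [Fin.sum_univ_succ]; linear_combination h) 0
    revert this; decide
  · exact pow_ne_of_order ho 13 (by norm_num) (by norm_num) h

lemma not_memB_3_4 : ¬ memB 3 2 3 4 := by
  refine not_memB 3 4 (by norm_num) fun L _ _ _ hp _ => ?_
  push_cast at hp
  refine ⟨algebraMap L[X] (RatFunc L) (X ^ 2 - 1) / algebraMap L[X] (RatFunc L) 1,
    mem_upsilon _ _ (X + 1) one_ne_zero
      ((by compute_degree : (X ^ 2 - 1 : L[X]).natDegree ≤ 2).trans (by norm_num)) (by simp)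
      isCoprime_one_right (by rw [C_1]; ring) ?_, ?_⟩
  · simp only [eval_add, eval_one, eval_X]
    intro h
    exact one_ne_zero (α := L) (by linear_combination hp - h)
  intro α hα hli ho
  norm_num at hα
  rw [ratEval_poly] at ho
  simp only [eval_add, eval_sub, eval_neg, eval_pow, eval_X, eval_one] at ho
  have hli' := Fintype.linearIndependent_iff.1 hli
  rcases case_3_4 hp α (pow_order hα) (pow_ne_of_order hα 40 (by norm_num) (by norm_num))
    (pow_ne_of_order hα 16 (by norm_num) (by norm_num)) with h | h | h | h
  · have := hli' ![1, 1, 1, 1] (by simp [Fin.sum_univ_succ]; linear_combination h) 0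
    revert this; decide
  · have := hli' ![1, -1, 1, -1] (by simp [Fin.sum_univ_succ]; linear_combination h) 0
    revert this; decide
  · exact pow_ne_of_order ho 16 (by norm_num) (by norm_num) h
  · exact pow_ne_of_order ho 40 (by norm_num) (by norm_num) h

theorem stmt18 :
    ¬ memB 3 2 2 3 ∧ ¬ memB 3 2 2 4 ∧ ¬ memB 3 2 2 6 ∧ ¬ memB 3 2 3 3 ∧ ¬ memB 3 2 3 4 ∧
    memB 3 2 2 5 ∧ memB 3 2 2 7 ∧ memB 3 2 2 11 ∧ memB 3 2 8 3 := by
  exact ⟨not_memB_2_3, not_memB_2_4, not_memB_2_6, not_memB_3_3, not_memB_3_4,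
    memB_2_5, memB_2_7, memB_2_11, memB_8_3⟩
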